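/- Let k be a commutative ring, R = k[x₁, …, x_N], W ∈ R, and let D be an n × n matrix over R with D * D = W • 1. Let J = (∂₁W, …, ∂_N W) ⊆ R be the Jacobian ideal of W. If X is an n × n matrix over R with D*X = X*D, then for every f ∈ J the matrix f • X lies in the range of the R-linear map Y ↦ D*Y + Y*D on matrices. Consequently the even on-shell boundary space, the quotient {X : D*X = X*D} / {D*Y + Y*D}, is a module over the Jacobian ring Jac(W) = R/J. -/

import Mathlib

/-- A derivation applied entrywise to a product of matrices obeys the Leibniz rule. -/
theorem Matrix.map_derivation_mul {k A m : Type*} [CommRing k] [CommRing A] [Algebra k A]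
    [Fintype m] (d : Derivation k A A) (M P : Matrix m m A) :
    (M * P).map d = M * P.map d + M.map d * P := by
  ext i j
  simp only [Matrix.map_apply, Matrix.mul_apply, Matrix.add_apply, map_sum, Derivation.leibniz,
    smul_eq_mul, Finset.sum_add_distrib]
  congr 1
  exact Finset.sum_congr rfl fun _ _ => mul_comm _ _

theorem Matrix.map_derivation_smul_one {k A m : Type*} [CommRing k] [CommRing A] [Algebra k A]
    [DecidableEq m] (d : Derivation k A A) (a : A) :
    ((a • 1 : Matrix m m A)).map d = d a • 1 := by
  ext i j
  by_cases h : i = j <;> simp [h]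

/-- The derivative of a square root `D` of `w • 1` gives a null-homotopy for the action of
`d w` on anything that commutes with `D`. -/
theorem Matrix.derivation_smul_eq_anticommutator {k A m : Type*} [CommRing k] [CommRing A]
    [Algebra k A] [Fintype m] [DecidableEq m] (d : Derivation k A A) {w : A}
    {D X : Matrix m m A} (hD : D * D = w • 1) (hX : D * X = X * D) :
    d w • X = D * (D.map d * X) + (D.map d * X) * D := by
  have h : d w • (1 : Matrix m m A) = D * D.map d + D.map d * D := by
    rw [← Matrix.map_derivation_mul, hD, Matrix.map_derivation_smul_one]
  calc d w • X = (d w • (1 : Matrix m m A)) * X := by rw [smul_mul_assoc, one_mul]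
    _ = D * (D.map d * X) + (D.map d * X) * D := by
      rw [h, add_mul, mul_assoc, mul_assoc, mul_assoc, hX]

/-- For a matrix factorization `D * D = W • 1` and an even BRST cocycle `X`
(`D*X = X*D`), every element `f` of the Jacobian ideal
`J = (∂₁W, …, ∂_N W)` acts null-homotopically: `f • X` lies in the range of
the map `Y ↦ D*Y + Y*D`. Hence the even on-shell boundary space is a module
over the Jacobian ring `Jac(W) = R/J`. -/
theorem jacobian_ideal_acts_nullhomotopically
    {k : Type*} [CommRing k] {N n : ℕ}
    (W : MvPolynomial (Fin N) k)
    (D X : Matrix (Fin n) (Fin n) (MvPolynomial (Fin N) k))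
    (hD : D * D = W • 1) (hX : D * X = X * D)
    (f : MvPolynomial (Fin N) k)
    (hf : f ∈ Ideal.span (Set.range fun j : Fin N => MvPolynomial.pderiv j W)) :
    ∃ Y : Matrix (Fin n) (Fin n) (MvPolynomial (Fin N) k),
      f • X = D * Y + Y * D := by
  induction hf using Submodule.span_induction with
  | mem g hg =>
    obtain ⟨j, rfl⟩ := hg
    exact ⟨_, Matrix.derivation_smul_eq_anticommutator (MvPolynomial.pderiv j) hD hX⟩
  | zero => exact ⟨0, by simp⟩
  | add g h _ _ hg hh =>
    obtain ⟨Y, hY⟩ := hg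
    obtain ⟨Z, hZ⟩ := hh
    exact ⟨Y + Z, by rw [add_smul, hY, hZ, mul_add, add_mul, add_add_add_comm]⟩
  | smul a g _ hg =>
    obtain ⟨Y, hY⟩ := hg
    exact ⟨a • Y, by rw [smul_assoc, hY, smul_add, mul_smul_comm, smul_mul_assoc]⟩
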